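/- A differential linear category has antiderivatives if and only if for the monoidal unit R there exists a map s_R : !R → !R satisfying [ftc.2], i.e. such that s_R d_R + !(0) = 1_{!R}. -/

import Mathlib

universe u v

/-- A symmetric strict monoidal category (data and the coherence axioms that
do not require transport along object equalities). Composition `comp f g`
is in diagrammatic order: first `f`, then `g`. -/
structure SMCData where
  Obj : Type u
  Hom : Obj → Obj → Type v
  id : ∀ A : Obj, Hom A A
  comp : ∀ {A B C : Obj}, Hom A B → Hom B C → Hom A C
  id_comp : ∀ {A B : Obj} (f : Hom A B), comp (id A) f = f
  comp_id : ∀ {A B : Obj} (f : Hom A B), comp f (id B) = f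
  comp_assoc : ∀ {A B C D : Obj} (f : Hom A B) (g : Hom B C) (h : Hom C D),
    comp (comp f g) h = comp f (comp g h)
  ten : Obj → Obj → Obj
  unit : Obj
  tHom : ∀ {A B C D : Obj}, Hom A C → Hom B D → Hom (ten A B) (ten C D)
  tHom_id : ∀ (A B : Obj), tHom (id A) (id B) = id (ten A B)
  tHom_comp : ∀ {A₁ A₂ A₃ B₁ B₂ B₃ : Obj} (f : Hom A₁ A₂) (g : Hom A₂ A₃)
    (f' : Hom B₁ B₂) (g' : Hom B₂ B₃),
    tHom (comp f g) (comp f' g') = comp (tHom f f') (tHom g g')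
  tenAssoc : ∀ (A B C : Obj), ten (ten A B) C = ten A (ten B C)
  unit_ten : ∀ (A : Obj), ten unit A = A
  ten_unit : ∀ (A : Obj), ten A unit = A
  sw : ∀ (A B : Obj), Hom (ten A B) (ten B A)
  sw_natural : ∀ {A B C D : Obj} (f : Hom A C) (g : Hom B D),
    comp (tHom f g) (sw C D) = comp (sw A B) (tHom g f)
  sw_sw : ∀ (A B : Obj), comp (sw A B) (sw B A) = id (ten A B)

/-- The identity morphism transported along an equality of objects. In a
strict monoidal category the structural isomorphisms are identities, so these
are used to express the strictness identifications. -/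
def SMCData.cHom (C : SMCData) {A B : C.Obj} (h : A = B) : C.Hom A B := by
  cases h; exact C.id A
/-- A differential linear category: a differential category whose coalgebra modality is a monoidal coalgebra modality. -/
structure DiffLinCat extends SMCData where
  -- strictness coherence: associativity and unit identifications are
  -- (transported) identities compatible with the tensor of morphisms,
  -- and the symmetry satisfies the (strict) hexagon identity
  assoc_natural : ∀ {A₁ A₂ B₁ B₂ C₁ C₂ : Obj} (f : Hom A₁ A₂) (g : Hom B₁ B₂) (h : Hom C₁ C₂),
    comp (tHom (tHom f g) h) (toSMCData.cHom (tenAssoc A₂ B₂ C₂)) =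
      comp (toSMCData.cHom (tenAssoc A₁ B₁ C₁)) (tHom f (tHom g h))
  unit_ten_natural : ∀ {A B : Obj} (f : Hom A B),
    comp (tHom (id unit) f) (toSMCData.cHom (unit_ten B)) =
      comp (toSMCData.cHom (unit_ten A)) f
  ten_unit_natural : ∀ {A B : Obj} (f : Hom A B),
    comp (tHom f (id unit)) (toSMCData.cHom (ten_unit B)) =
      comp (toSMCData.cHom (ten_unit A)) f
  hexagon : ∀ (A B C : Obj),
    comp (toSMCData.cHom (tenAssoc A B C))
      (comp (tHom (id A) (sw B C))
        (comp (toSMCData.cHom (tenAssoc A C B).symm)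
          (comp (tHom (sw A C) (id B)) (toSMCData.cHom (tenAssoc C A B))))) =
      sw (ten A B) C
  -- additive enrichment: hom-sets are commutative monoids and composition
  -- and tensor preserve the additive structure
  add : ∀ {A B : Obj}, Hom A B → Hom A B → Hom A B
  zero : ∀ {A B : Obj}, Hom A B
  add_assoc : ∀ {A B : Obj} (f g h : Hom A B), add (add f g) h = add f (add g h)
  add_comm : ∀ {A B : Obj} (f g : Hom A B), add f g = add g f
  add_zero : ∀ {A B : Obj} (f : Hom A B), add f zero = f
  comp_add : ∀ {A B C : Obj} (f : Hom A B) (g h : Hom B C),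
    comp f (add g h) = add (comp f g) (comp f h)
  add_comp : ∀ {A B C : Obj} (f g : Hom A B) (h : Hom B C),
    comp (add f g) h = add (comp f h) (comp g h)
  comp_zero : ∀ {A B C : Obj} (f : Hom A B), comp f (zero : Hom B C) = zero
  zero_comp : ∀ {A B C : Obj} (f : Hom B C), comp (zero : Hom A B) f = zero
  tHom_add_left : ∀ {A B C D : Obj} (f g : Hom A C) (h : Hom B D),
    tHom (add f g) h = add (tHom f h) (tHom g h)
  tHom_add_right : ∀ {A B C D : Obj} (f : Hom A C) (g h : Hom B D),
    tHom f (add g h) = add (tHom f g) (tHom f h)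
  tHom_zero_left : ∀ {A B C D : Obj} (h : Hom B D),
    tHom (zero : Hom A C) h = zero
  tHom_zero_right : ∀ {A B C D : Obj} (f : Hom A C),
    tHom f (zero : Hom B D) = zero
  -- a coalgebra modality: a comonad (bang, rho, eps) with natural
  -- cocommutative comonoid structure (cmul, cunit) on each bang A,
  -- for which each rho A is a comonoid morphism
  bang : Obj → Obj
  bangMap : ∀ {A B : Obj}, Hom A B → Hom (bang A) (bang B)
  bangMap_id : ∀ (A : Obj), bangMap (id A) = id (bang A)
  bangMap_comp : ∀ {A B C : Obj} (f : Hom A B) (g : Hom B C),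
    bangMap (comp f g) = comp (bangMap f) (bangMap g)
  rho : ∀ (A : Obj), Hom (bang A) (bang (bang A))
  eps : ∀ (A : Obj), Hom (bang A) A
  cmul : ∀ (A : Obj), Hom (bang A) (ten (bang A) (bang A))
  cunit : ∀ (A : Obj), Hom (bang A) unit
  rho_natural : ∀ {A B : Obj} (f : Hom A B),
    comp (bangMap f) (rho B) = comp (rho A) (bangMap (bangMap f))
  eps_natural : ∀ {A B : Obj} (f : Hom A B),
    comp (bangMap f) (eps B) = comp (eps A) f
  cmul_natural : ∀ {A B : Obj} (f : Hom A B),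
    comp (bangMap f) (cmul B) = comp (cmul A) (tHom (bangMap f) (bangMap f))
  cunit_natural : ∀ {A B : Obj} (f : Hom A B),
    comp (bangMap f) (cunit B) = cunit A
  rho_eps : ∀ (A : Obj), comp (rho A) (eps (bang A)) = id (bang A)
  rho_bangMap_eps : ∀ (A : Obj), comp (rho A) (bangMap (eps A)) = id (bang A)
  rho_rho : ∀ (A : Obj), comp (rho A) (rho (bang A)) = comp (rho A) (bangMap (rho A))
  cmul_coassoc : ∀ (A : Obj),
    comp (cmul A) (comp (tHom (cmul A) (id (bang A)))
      (toSMCData.cHom (tenAssoc (bang A) (bang A) (bang A)))) =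
    comp (cmul A) (tHom (id (bang A)) (cmul A))
  cmul_counit_left : ∀ (A : Obj),
    comp (cmul A) (comp (tHom (cunit A) (id (bang A)))
      (toSMCData.cHom (unit_ten (bang A)))) = id (bang A)
  cmul_counit_right : ∀ (A : Obj),
    comp (cmul A) (comp (tHom (id (bang A)) (cunit A))
      (toSMCData.cHom (ten_unit (bang A)))) = id (bang A)
  cmul_cocomm : ∀ (A : Obj), comp (cmul A) (sw (bang A) (bang A)) = cmul A
  rho_cmul : ∀ (A : Obj),
    comp (rho A) (cmul (bang A)) = comp (cmul A) (tHom (rho A) (rho A))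
  rho_cunit : ∀ (A : Obj), comp (rho A) (cunit (bang A)) = cunit A
  -- a deriving transformation [d.1]-[d.5]
  der : ∀ (A : Obj), Hom (ten (bang A) A) (bang A)
  der_natural : ∀ {A B : Obj} (f : Hom A B),
    comp (tHom (bangMap f) f) (der B) = comp (der A) (bangMap f)
  -- [d.1] constant rule
  der_cunit : ∀ (A : Obj), comp (der A) (cunit A) = zero
  -- [d.2] Leibniz rule
  der_cmul : ∀ (A : Obj),
    comp (der A) (cmul A) =
      add
        (comp (tHom (cmul A) (id A))
          (comp (toSMCData.cHom (tenAssoc (bang A) (bang A) A))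
            (comp (tHom (id (bang A)) (sw (bang A) A))
              (comp (toSMCData.cHom (tenAssoc (bang A) A (bang A)).symm)
                (tHom (der A) (id (bang A)))))))
        (comp (tHom (cmul A) (id A))
          (comp (toSMCData.cHom (tenAssoc (bang A) (bang A) A))
            (tHom (id (bang A)) (der A))))
  -- [d.3] linear rule
  der_eps : ∀ (A : Obj),
    comp (der A) (eps A) = comp (tHom (cunit A) (id A)) (toSMCData.cHom (unit_ten A))
  -- [d.4] chain rule
  der_rho : ∀ (A : Obj),
    comp (der A) (rho A) =
      comp (tHom (cmul A) (id A))
        (comp (toSMCData.cHom (tenAssoc (bang A) (bang A) A))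
          (comp (tHom (rho A) (der A)) (der (bang A))))
  -- [d.5] interchange rule
  der_interchange : ∀ (A : Obj),
    comp (tHom (der A) (id A)) (der A) =
      comp (toSMCData.cHom (tenAssoc (bang A) A A))
        (comp (tHom (id (bang A)) (sw A A))
          (comp (toSMCData.cHom (tenAssoc (bang A) A A).symm)
            (comp (tHom (der A) (id A)) (der A))))
  -- monoidal coalgebra modality structure: (bang, m, mUnit) is a symmetric
  -- monoidal functor, rho, eps, cmul, cunit are monoidal transformations and
  -- cmul, cunit are bang-coalgebra morphisms
  m : ∀ (A B : Obj), Hom (ten (bang A) (bang B)) (bang (ten A B))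
  mUnit : Hom unit (bang unit)
  m_natural : ∀ {A A' B B' : Obj} (f : Hom A A') (g : Hom B B'),
    comp (tHom (bangMap f) (bangMap g)) (m A' B') = comp (m A B) (bangMap (tHom f g))
  m_assoc : ∀ (A B C : Obj),
    comp (tHom (m A B) (id (bang C)))
      (comp (m (ten A B) C) (bangMap (toSMCData.cHom (tenAssoc A B C)))) =
    comp (toSMCData.cHom (tenAssoc (bang A) (bang B) (bang C)))
      (comp (tHom (id (bang A)) (m B C)) (m A (ten B C)))
  m_unit_left : ∀ (A : Obj),
    comp (toSMCData.cHom (unit_ten (bang A)).symm)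
      (comp (tHom mUnit (id (bang A)))
        (comp (m unit A) (bangMap (toSMCData.cHom (unit_ten A))))) = id (bang A)
  m_unit_right : ∀ (A : Obj),
    comp (toSMCData.cHom (ten_unit (bang A)).symm)
      (comp (tHom (id (bang A)) mUnit)
        (comp (m A unit) (bangMap (toSMCData.cHom (ten_unit A))))) = id (bang A)
  m_sw : ∀ (A B : Obj),
    comp (sw (bang A) (bang B)) (m B A) = comp (m A B) (bangMap (sw A B))
  m_rho : ∀ (A B : Obj),
    comp (m A B) (rho (ten A B)) =
      comp (tHom (rho A) (rho B)) (comp (m (bang A) (bang B)) (bangMap (m A B)))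
  mUnit_rho : comp mUnit (rho unit) = comp mUnit (bangMap mUnit)
  m_eps : ∀ (A B : Obj), comp (m A B) (eps (ten A B)) = tHom (eps A) (eps B)
  mUnit_eps : comp mUnit (eps unit) = id unit
  m_cmul : ∀ (A B : Obj),
    comp (m A B) (cmul (ten A B)) =
      comp (tHom (cmul A) (cmul B))
        (comp (toSMCData.cHom (tenAssoc (bang A) (bang A) (ten (bang B) (bang B))))
          (comp (tHom (id (bang A)) (toSMCData.cHom (tenAssoc (bang A) (bang B) (bang B)).symm))
            (comp (tHom (id (bang A)) (tHom (sw (bang A) (bang B)) (id (bang B))))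
              (comp (tHom (id (bang A)) (toSMCData.cHom (tenAssoc (bang B) (bang A) (bang B))))
                (comp (toSMCData.cHom (tenAssoc (bang A) (bang B) (ten (bang A) (bang B))).symm)
                  (tHom (m A B) (m A B)))))))
  m_cunit : ∀ (A B : Obj),
    comp (m A B) (cunit (ten A B)) =
      comp (tHom (cunit A) (cunit B)) (toSMCData.cHom (unit_ten unit))
  mUnit_cmul : comp mUnit (cmul unit) =
    comp (toSMCData.cHom (unit_ten unit).symm) (tHom mUnit mUnit)
  mUnit_cunit : comp mUnit (cunit unit) = id unit
  cmul_coalg : ∀ (A : Obj),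
    comp (rho A) (bangMap (cmul A)) =
      comp (cmul A) (comp (tHom (rho A) (rho A)) (m (bang A) (bang A)))
  cunit_coalg : ∀ (A : Obj),
    comp (rho A) (bangMap (cunit A)) = comp (cunit A) mUnit

def DiffLinCat.cHom (C : DiffLinCat) {A B : C.Obj} (h : A = B) : C.Hom A B :=
  C.toSMCData.cHom h

namespace DiffLinCat

variable (C : DiffLinCat)

/-- The coderiving transformation d°_A := Δ_A (1 ⊗ ε_A). -/
def dcirc (A : C.Obj) : C.Hom (C.bang A) (C.ten (C.bang A) A) :=
  C.comp (C.cmul A) (C.tHom (C.id (C.bang A)) (C.eps A))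

/-- K_A := d°_A d_A + !(0). -/
def K (A : C.Obj) : C.Hom (C.bang A) (C.bang A) :=
  C.add (C.comp (C.dcirc A) (C.der A)) (C.bangMap (C.zero : C.Hom A A))

/-- J_A := d°_A d_A + 1_{!A}. -/
def J (A : C.Obj) : C.Hom (C.bang A) (C.bang A) :=
  C.add (C.comp (C.dcirc A) (C.der A)) (C.id (C.bang A))

/-- The deriving transformation at the monoidal unit, under the strictness
identification !R ⊗ R = !R. -/
def dR : C.Hom (C.bang C.unit) (C.bang C.unit) :=
  C.comp (C.cHom (C.ten_unit (C.bang C.unit)).symm) (C.der C.unit)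

/-- The coderiving transformation at the monoidal unit, under the strictness
identification !R ⊗ R = !R. -/
def dcircR : C.Hom (C.bang C.unit) (C.bang C.unit) :=
  C.comp (C.dcirc C.unit) (C.cHom (C.ten_unit (C.bang C.unit)))

end DiffLinCat

namespace SMCData

theorem cHom_comp_cHom (C : SMCData) {A B D : C.Obj} (h : A = B) (k : B = D) :
    C.comp (C.cHom h) (C.cHom k) = C.cHom (h.trans k) := by
  subst h k
  exact C.id_comp _

theorem tHom_cHom_cHom (C : SMCData) {A B A' B' : C.Obj} (h : A = B) (k : A' = B') :
    C.tHom (C.cHom h) (C.cHom k) = C.cHom (congrArg₂ C.ten h k) := by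
  subst h k
  exact C.tHom_id _ _

end SMCData

namespace DiffLinCat

open CategoryTheory MonoidalCategory BraidedCategory

instance (C : DiffLinCat) : Category C.Obj where
  Hom := C.Hom
  id := C.id
  comp := C.comp
  id_comp := C.id_comp
  comp_id := C.comp_id
  assoc := C.comp_assoc

/-- The identity along an equality of objects, as an isomorphism. -/
def castIso (C : DiffLinCat) {A B : C.Obj} (h : A = B) : A ≅ B where
  hom := C.toSMCData.cHom h
  inv := C.toSMCData.cHom h.symm
  hom_inv_id := C.cHom_comp_cHom h h.symm
  inv_hom_id := C.cHom_comp_cHom h.symm h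

instance (C : DiffLinCat) : MonoidalCategoryStruct C.Obj where
  tensorObj := C.ten
  tensorUnit := C.unit
  tensorHom := C.tHom
  whiskerLeft A _ _ f := C.tHom (C.id A) f
  whiskerRight f B := C.tHom f (C.id B)
  associator A B D := C.castIso (C.tenAssoc A B D)
  leftUnitor A := C.castIso (C.unit_ten A)
  rightUnitor A := C.castIso (C.ten_unit A)

theorem tHom_cHom_id (C : DiffLinCat) {A B : C.Obj} (h : A = B) (D : C.Obj) :
    C.tHom (C.toSMCData.cHom h) (C.id D) = C.toSMCData.cHom (congrArg (C.ten · D) h) :=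
  C.tHom_cHom_cHom h rfl

theorem tHom_id_cHom (C : DiffLinCat) {A B : C.Obj} (h : A = B) (D : C.Obj) :
    C.tHom (C.id D) (C.toSMCData.cHom h) = C.toSMCData.cHom (congrArg (C.ten D) h) :=
  C.tHom_cHom_cHom rfl h

instance (C : DiffLinCat) : MonoidalCategory C.Obj :=
  MonoidalCategory.ofTensorHom
    (id_tensorHom_id := C.tHom_id)
    (id_tensorHom := fun _ _ _ _ => rfl)
    (tensorHom_id := fun _ _ => rfl)
    (tensorHom_comp_tensorHom := fun f₁ f₂ g₁ g₂ => (C.tHom_comp f₁ g₁ f₂ g₂).symm)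
    (associator_naturality := C.assoc_natural)
    (leftUnitor_naturality := C.unit_ten_natural)
    (rightUnitor_naturality := C.ten_unit_natural)
    (pentagon := fun _ _ _ _ => by
      refine (congrArg₂ C.comp (C.tHom_cHom_id _ _)
        (congrArg (C.comp _) (C.tHom_id_cHom _ _))).trans ?_
      exact (congrArg (C.comp _) (C.cHom_comp_cHom _ _)).trans
        ((C.cHom_comp_cHom _ _).trans (C.cHom_comp_cHom _ _).symm))
    (triangle := fun _ _ =>
      (congrArg (C.comp _) (C.tHom_id_cHom _ _)).trans
        ((C.cHom_comp_cHom _ _).trans (C.tHom_cHom_id _ _).symm))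

/-- The symmetry as an isomorphism. -/
def swIso (C : DiffLinCat) (A B : C.Obj) : A ⊗ B ≅ B ⊗ A where
  hom := C.sw A B
  inv := C.sw B A
  hom_inv_id := C.sw_sw A B
  inv_hom_id := C.sw_sw B A

theorem swIso_tensor_left (C : DiffLinCat) (X Y Z : C.Obj) :
    (α_ X Y Z).hom ≫ X ◁ (C.swIso Y Z).hom ≫ (α_ X Z Y).inv ≫ (C.swIso X Z).hom ▷ Y ≫
      (α_ Z X Y).hom = (C.swIso (X ⊗ Y) Z).hom :=
  C.hexagon X Y Z

theorem swIso_tensor_right (C : DiffLinCat) (X Y Z : C.Obj) :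
    (α_ Z X Y).inv ≫ (C.swIso Z X).hom ▷ Y ≫ (α_ X Z Y).hom ≫ X ◁ (C.swIso Z Y).hom ≫
      (α_ X Y Z).inv = (C.swIso Z (X ⊗ Y)).hom := by
  have h : (C.swIso (X ⊗ Y) Z).inv = (C.swIso Z (X ⊗ Y)).hom := rfl
  rw [← h, ← Iso.cancel_iso_hom_left (C.swIso (X ⊗ Y) Z), Iso.hom_inv_id, ← swIso_tensor_left]
  have hY : (C.swIso Z Y).hom = (C.swIso Y Z).inv := rfl
  have hX : (C.swIso Z X).hom = (C.swIso X Z).inv := rfl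
  simp [hX, hY]

instance (C : DiffLinCat) : SymmetricCategory C.Obj where
  braiding := C.swIso
  braiding_naturality_right X _ _ f := C.sw_natural (C.id X) f
  braiding_naturality_left f Z := C.sw_natural f (C.id Z)
  hexagon_forward X Y Z := by
    rw [← swIso_tensor_right]
    simp
  hexagon_reverse X Y Z := by
    rw [← swIso_tensor_left]
    simp
  symmetry X Y := C.sw_sw X Y

instance (C : DiffLinCat) (A B : C.Obj) : Add (A ⟶ B) := ⟨C.add⟩

instance (C : DiffLinCat) (A B : C.Obj) : Zero (A ⟶ B) := ⟨C.zero⟩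

instance (C : DiffLinCat) (A B : C.Obj) : AddCommMonoid (A ⟶ B) where
  add_assoc := C.add_assoc
  add_comm := C.add_comm
  add_zero := C.add_zero
  zero_add f := (C.add_comm _ _).trans (C.add_zero f)
  nsmul := nsmulRec

variable {C : DiffLinCat}

section Structure

theorem hom_comp_add {X Y Z : C.Obj} (f : X ⟶ Y) (g h : Y ⟶ Z) : f ≫ (g + h) = f ≫ g + f ≫ h :=
  C.comp_add f g h

theorem hom_add_comp {X Y Z : C.Obj} (f g : X ⟶ Y) (h : Y ⟶ Z) : (f + g) ≫ h = f ≫ h + g ≫ h :=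
  C.add_comp f g h

theorem hom_comp_zero {X Y Z : C.Obj} (f : X ⟶ Y) : f ≫ (0 : Y ⟶ Z) = 0 :=
  C.comp_zero f

theorem hom_zero_comp {X Y Z : C.Obj} (f : Y ⟶ Z) : (0 : X ⟶ Y) ≫ f = 0 :=
  C.zero_comp f

theorem whiskerLeft_add (X : C.Obj) {Y Z : C.Obj} (f g : Y ⟶ Z) :
    X ◁ (f + g) = X ◁ f + X ◁ g :=
  C.tHom_add_right (C.id X) f g

theorem add_whiskerRight {Y Z : C.Obj} (f g : Y ⟶ Z) (X : C.Obj) :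
    (f + g) ▷ X = f ▷ X + g ▷ X :=
  C.tHom_add_left f g (C.id X)

theorem whiskerLeft_zero (X : C.Obj) {Y Z : C.Obj} : X ◁ (0 : Y ⟶ Z) = 0 :=
  C.tHom_zero_right (C.id X)

theorem tensorHom_zero {W X Y Z : C.Obj} (f : W ⟶ X) : f ⊗ₘ (0 : Y ⟶ Z) = 0 :=
  C.tHom_zero_right f

/-- The action of the modality on morphisms. -/
def fmap {A B : C.Obj} (f : A ⟶ B) : C.bang A ⟶ C.bang B := C.bangMap f

/-- The comultiplication of the comonad. -/
def dig (A : C.Obj) : C.bang A ⟶ C.bang (C.bang A) := C.rho A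

/-- The counit of the comonad. -/
def derel (A : C.Obj) : C.bang A ⟶ A := C.eps A

/-- The comultiplication of the comonoid `!A`. -/
def contr (A : C.Obj) : C.bang A ⟶ C.bang A ⊗ C.bang A := C.cmul A

/-- The counit of the comonoid `!A`. -/
def weak (A : C.Obj) : C.bang A ⟶ 𝟙_ C.Obj := C.cunit A

/-- The deriving transformation. -/
def diff (A : C.Obj) : C.bang A ⊗ A ⟶ C.bang A := C.der A

/-- The coderiving transformation. -/
def coder (A : C.Obj) : C.bang A ⟶ C.bang A ⊗ A := contr A ≫ C.bang A ◁ derel A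

/-- The lax monoidal structure map of the modality. -/
def mon (A B : C.Obj) : C.bang A ⊗ C.bang B ⟶ C.bang (A ⊗ B) := C.m A B

/-- The lax monoidal unit map of the modality. -/
def monUnit (C : DiffLinCat) : 𝟙_ C.Obj ⟶ C.bang (𝟙_ C.Obj) := C.mUnit

theorem fmap_id (A : C.Obj) : fmap (𝟙 A) = 𝟙 (C.bang A) := C.bangMap_id A

theorem fmap_comp {X Y Z : C.Obj} (f : X ⟶ Y) (g : Y ⟶ Z) : fmap (f ≫ g) = fmap f ≫ fmap g :=
  C.bangMap_comp f g

theorem fmap_derel {X Y : C.Obj} (f : X ⟶ Y) : fmap f ≫ derel Y = derel X ≫ f :=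
  C.eps_natural f

theorem fmap_contr {X Y : C.Obj} (f : X ⟶ Y) :
    fmap f ≫ contr Y = contr X ≫ (fmap f ⊗ₘ fmap f) :=
  C.cmul_natural f

theorem dig_derel (A : C.Obj) : dig A ≫ derel (C.bang A) = 𝟙 _ := C.rho_eps A

theorem dig_fmap_derel (A : C.Obj) : dig A ≫ fmap (derel A) = 𝟙 _ := C.rho_bangMap_eps A

theorem contr_coassoc (A : C.Obj) :
    contr A ≫ contr A ▷ C.bang A ≫ (α_ _ _ _).hom = contr A ≫ C.bang A ◁ contr A :=
  C.cmul_coassoc A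

theorem contr_weak_left (A : C.Obj) : contr A ≫ weak A ▷ C.bang A ≫ (λ_ _).hom = 𝟙 _ :=
  C.cmul_counit_left A

theorem contr_weak_right (A : C.Obj) : contr A ≫ C.bang A ◁ weak A ≫ (ρ_ _).hom = 𝟙 _ :=
  C.cmul_counit_right A

theorem contr_braiding (A : C.Obj) : contr A ≫ (β_ _ _).hom = contr A := C.cmul_cocomm A

theorem dig_contr (A : C.Obj) : dig A ≫ contr (C.bang A) = contr A ≫ (dig A ⊗ₘ dig A) :=
  C.rho_cmul A

theorem dig_weak (A : C.Obj) : dig A ≫ weak (C.bang A) = weak A := C.rho_cunit A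

theorem diff_natural {X Y : C.Obj} (f : X ⟶ Y) :
    (fmap f ⊗ₘ f) ≫ diff Y = diff X ≫ fmap f :=
  C.der_natural f

theorem diff_weak (A : C.Obj) : diff A ≫ weak A = 0 := C.der_cunit A

theorem diff_contr (A : C.Obj) :
    diff A ≫ contr A =
      contr A ▷ A ≫ (α_ _ _ _).hom ≫ C.bang A ◁ (β_ _ _).hom ≫ (α_ _ _ _).inv ≫
          diff A ▷ C.bang A +
        contr A ▷ A ≫ (α_ _ _ _).hom ≫ C.bang A ◁ diff A :=
  C.der_cmul A

theorem diff_derel (A : C.Obj) : diff A ≫ derel A = weak A ▷ A ≫ (λ_ A).hom :=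
  C.der_eps A

theorem diff_dig (A : C.Obj) :
    diff A ≫ dig A =
      contr A ▷ A ≫ (α_ _ _ _).hom ≫ (dig A ⊗ₘ diff A) ≫ diff (C.bang A) :=
  C.der_rho A

theorem diff_interchange (A : C.Obj) :
    diff A ▷ A ≫ diff A =
      (α_ _ _ _).hom ≫ C.bang A ◁ (β_ A A).hom ≫ (α_ _ _ _).inv ≫
        diff A ▷ A ≫ diff A :=
  C.der_interchange A

theorem mon_natural {X X' Y Y' : C.Obj} (f : X ⟶ X') (g : Y ⟶ Y') :
    (fmap f ⊗ₘ fmap g) ≫ mon X' Y' = mon X Y ≫ fmap (f ⊗ₘ g) :=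
  C.m_natural f g

theorem mon_unit_left (A : C.Obj) :
    (λ_ (C.bang A)).inv ≫ C.monUnit ▷ C.bang A ≫ mon (𝟙_ _) A ≫ fmap (λ_ A).hom = 𝟙 _ :=
  C.m_unit_left A

theorem mon_unit_right (A : C.Obj) :
    (ρ_ (C.bang A)).inv ≫ C.bang A ◁ C.monUnit ≫ mon A (𝟙_ _) ≫ fmap (ρ_ A).hom = 𝟙 _ :=
  C.m_unit_right A

theorem braiding_mon (X Y : C.Obj) :
    (β_ (C.bang X) (C.bang Y)).hom ≫ mon Y X = mon X Y ≫ fmap (β_ X Y).hom :=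
  C.m_sw X Y

theorem mon_derel (X Y : C.Obj) : mon X Y ≫ derel (X ⊗ Y) = derel X ⊗ₘ derel Y := C.m_eps X Y

theorem monUnit_derel : C.monUnit ≫ derel _ = 𝟙 _ := C.mUnit_eps

theorem mon_contr (X Y : C.Obj) :
    mon X Y ≫ contr (X ⊗ Y) =
      (contr X ⊗ₘ contr Y) ≫ tensorμ _ _ _ _ ≫ (mon X Y ⊗ₘ mon X Y) := by
  simp only [tensorμ, Category.assoc]
  exact C.m_cmul X Y

theorem mon_weak (X Y : C.Obj) :
    mon X Y ≫ weak (X ⊗ Y) = (weak X ⊗ₘ weak Y) ≫ (λ_ (𝟙_ C.Obj)).hom :=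
  C.m_cunit X Y

theorem monUnit_contr :
    C.monUnit ≫ contr _ = (λ_ (𝟙_ C.Obj)).inv ≫ (C.monUnit ⊗ₘ C.monUnit) :=
  C.mUnit_cmul

theorem dig_fmap_contr (A : C.Obj) :
    dig A ≫ fmap (contr A) = contr A ≫ (dig A ⊗ₘ dig A) ≫ mon _ _ :=
  C.cmul_coalg A

theorem dig_fmap_weak (A : C.Obj) : dig A ≫ fmap (weak A) = weak A ≫ C.monUnit :=
  C.cunit_coalg A

end Structure

section MonoidalRule

/-- The `!`-coalgebra structure carried by `!A ⊗ !B`. -/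
def coalg (A B : C.Obj) : C.bang A ⊗ C.bang B ⟶ C.bang (C.bang A ⊗ C.bang B) :=
  (dig A ⊗ₘ dig B) ≫ mon _ _

/-- The comultiplication of the comonoid `!A ⊗ !B`. -/
def tensorContr (A B : C.Obj) :
    C.bang A ⊗ C.bang B ⟶ (C.bang A ⊗ C.bang B) ⊗ (C.bang A ⊗ C.bang B) :=
  (contr A ⊗ₘ contr B) ≫ tensorμ _ _ _ _

/-- The first linear projection of `!A ⊗ !B`. -/
def projL (A B : C.Obj) : C.bang A ⊗ C.bang B ⟶ A := (derel A ⊗ₘ weak B) ≫ (ρ_ A).hom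

/-- The second linear projection of `!A ⊗ !B`. -/
def projR (A B : C.Obj) : C.bang A ⊗ C.bang B ⟶ B := (weak A ⊗ₘ derel B) ≫ (λ_ B).hom

/-- Differentiation in the second variable. -/
def partialDiff (A B : C.Obj) : (C.bang A ⊗ C.bang B) ⊗ B ⟶ C.bang A ⊗ C.bang B :=
  (α_ _ _ _).hom ≫ C.bang A ◁ diff B

theorem coalg_derel (A B : C.Obj) : coalg A B ≫ derel _ = 𝟙 _ := by
  simp [coalg, mon_derel, tensorHom_comp_tensorHom, dig_derel]

theorem coalg_fmap_projL (A B : C.Obj) :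
    coalg A B ≫ fmap (projL A B) = C.bang A ◁ weak B ≫ (ρ_ _).hom := by
  rw [coalg, projL, fmap_comp, Category.assoc, ← reassoc_of% mon_natural,
    tensorHom_comp_tensorHom_assoc, dig_fmap_derel, dig_fmap_weak]
  have h := mon_unit_right A
  rw [Iso.inv_comp_eq, Category.comp_id] at h
  rw [id_tensorHom, whiskerLeft_comp, Category.assoc, h]

theorem coalg_fmap_projR (A B : C.Obj) :
    coalg A B ≫ fmap (projR A B) = weak A ▷ C.bang B ≫ (λ_ _).hom := by
  rw [coalg, projR, fmap_comp, Category.assoc, ← reassoc_of% mon_natural,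
    tensorHom_comp_tensorHom_assoc, dig_fmap_derel, dig_fmap_weak]
  have h := mon_unit_left B
  rw [Iso.inv_comp_eq, Category.comp_id] at h
  rw [tensorHom_id, comp_whiskerRight, Category.assoc, h]

theorem coalg_weak (A B : C.Obj) :
    coalg A B ≫ weak _ = (weak A ⊗ₘ weak B) ≫ (λ_ (𝟙_ C.Obj)).hom := by
  rw [coalg, Category.assoc, mon_weak, tensorHom_comp_tensorHom_assoc, dig_weak, dig_weak]

theorem coalg_contr (A B : C.Obj) :
    coalg A B ≫ contr _ = tensorContr A B ≫ (coalg A B ⊗ₘ coalg A B) := by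
  simp only [coalg, tensorContr, Category.assoc, mon_contr]
  rw [tensorHom_comp_tensorHom_assoc, dig_contr, dig_contr, ← tensorHom_comp_tensorHom_assoc,
    reassoc_of% tensorμ_natural, tensorHom_comp_tensorHom]

theorem tensorContr_proj (A B : C.Obj) :
    tensorContr A B ≫
      ((C.bang A ◁ weak B ≫ (ρ_ _).hom) ⊗ₘ (weak A ▷ C.bang B ≫ (λ_ _).hom)) = 𝟙 _ := by
  have hA : contr A ≫ C.bang A ◁ weak A = (ρ_ _).inv := by
    rw [← cancel_mono (ρ_ _).hom, Category.assoc, contr_weak_right, Iso.inv_hom_id]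
  have hB : contr B ≫ weak B ▷ C.bang B = (λ_ _).inv := by
    rw [← cancel_mono (λ_ _).hom, Category.assoc, contr_weak_left, Iso.inv_hom_id]
  rw [tensorContr, ← tensorHom_comp_tensorHom, ← id_tensorHom, ← tensorHom_id, Category.assoc,
    ← reassoc_of% tensorμ_natural, tensorHom_comp_tensorHom_assoc, id_tensorHom, tensorHom_id,
    hA, hB]
  have h1 : (β_ (𝟙_ C.Obj) (𝟙_ C.Obj)).hom = 𝟙 _ := by
    rw [braiding_tensorUnit_left, unitors_equal, Iso.hom_inv_id]
  simp only [tensorμ, h1]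
  monoidal

theorem coalg_contr_proj (A B : C.Obj) :
    coalg A B ≫ contr _ ≫ (fmap (projL A B) ⊗ₘ fmap (projR A B)) = 𝟙 _ := by
  rw [reassoc_of% coalg_contr, tensorHom_comp_tensorHom, coalg_fmap_projL, coalg_fmap_projR,
    tensorContr_proj]

theorem contr_mon (A : C.Obj) :
    contr A ≫ mon A A = dig A ≫ fmap (contr A ≫ (derel A ⊗ₘ derel A)) := by
  rw [fmap_comp, reassoc_of% dig_fmap_contr, ← mon_natural, tensorHom_comp_tensorHom_assoc,
    dig_fmap_derel, id_tensorHom_id, Category.id_comp]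

theorem coalg_contr_derel_weak (A B : C.Obj) :
    coalg A B ≫ contr _ ≫ _ ◁ (derel _ ≫ (weak A ⊗ₘ weak B) ≫ (λ_ (𝟙_ C.Obj)).hom) =
      coalg A B ≫ (ρ_ _).inv := by
  have h : contr (C.bang A ⊗ C.bang B) ≫ _ ◁ weak _ = (ρ_ _).inv := by
    rw [← cancel_mono (ρ_ _).hom, Category.assoc, contr_weak_right, Iso.inv_hom_id]
  rw [← h, ← coalg_weak, reassoc_of% coalg_contr, reassoc_of% coalg_contr]
  simp only [← id_tensorHom, tensorHom_comp_tensorHom]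
  rw [reassoc_of% coalg_derel]

theorem partialDiff_projL (A B : C.Obj) : partialDiff A B ≫ projL A B = 0 := by
  rw [partialDiff, projL, ← id_tensorHom, Category.assoc, tensorHom_comp_tensorHom_assoc,
    diff_weak, tensorHom_zero, hom_zero_comp, hom_comp_zero]

theorem partialDiff_derel (A B : C.Obj) :
    partialDiff A B ≫ (derel A ⊗ₘ derel B) =
      (α_ _ _ _).hom ≫ (derel A ⊗ₘ (weak B ▷ B ≫ (λ_ _).hom)) := by
  rw [partialDiff, ← id_tensorHom, Category.assoc, tensorHom_comp_tensorHom,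
    diff_derel, Category.id_comp]

theorem partialDiff_projR (A B : C.Obj) :
    partialDiff A B ≫ projR A B =
      ((weak A ⊗ₘ weak B) ≫ (λ_ (𝟙_ C.Obj)).hom) ▷ B ≫ (λ_ B).hom := by
  rw [partialDiff, projR, ← id_tensorHom, Category.assoc, tensorHom_comp_tensorHom_assoc,
    diff_derel, Category.id_comp]
  simp [MonoidalCategory.tensorHom_def]

theorem contr_whiskerRight_coassoc {X Y B : C.Obj} (f : C.bang X ⊗ B ⟶ Y) :
    (contr X ▷ B ≫ (α_ _ _ _).hom ≫ C.bang X ◁ f) ≫ contr X ▷ Y ≫ (α_ _ _ _).hom =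
      contr X ▷ B ≫ (α_ _ _ _).hom ≫
        C.bang X ◁ (contr X ▷ B ≫ (α_ _ _ _).hom ≫ C.bang X ◁ f) := by
  have h := congrArg (· ▷ B ≫ (α_ _ _ _).hom ≫ C.bang X ◁ (α_ _ _ _).hom ≫
    C.bang X ◁ C.bang X ◁ f) (contr_coassoc X)
  simp only [Category.assoc, whisker_exchange_assoc]
  simp at h ⊢
  exact h

/-- The tangent vector at a point of `!(!A ⊗ !B)` induced by one of `B`. -/
def tangent (A B : C.Obj) :
    C.bang (C.bang A ⊗ C.bang B) ⊗ B ⟶ C.bang (C.bang A ⊗ C.bang B) ⊗ (C.bang A ⊗ C.bang B) :=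
  contr _ ▷ B ≫ (α_ _ _ _).hom ≫ _ ◁ (derel _ ▷ B ≫ partialDiff A B)

theorem tangent_contr (A B : C.Obj) :
    tangent A B ≫ contr _ ▷ _ ≫ (α_ _ _ _).hom =
      contr _ ▷ B ≫ (α_ _ _ _).hom ≫ _ ◁ tangent A B :=
  contr_whiskerRight_coassoc _

theorem coalg_tangent_projL (A B : C.Obj) :
    coalg A B ▷ B ≫ tangent A B ≫ _ ◁ projL A B = 0 := by
  simp only [tangent, Category.assoc, ← whiskerLeft_comp, partialDiff_projL, hom_comp_zero,
    whiskerLeft_zero]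

theorem coalg_tangent_projR (A B : C.Obj) :
    coalg A B ▷ B ≫ tangent A B ≫ _ ◁ projR A B = coalg A B ▷ B := by
  simp only [tangent, Category.assoc, ← whiskerLeft_comp, partialDiff_projR]
  have h := congrArg (· ▷ B ≫ (α_ _ _ _).hom ≫ _ ◁ (λ_ _).hom) (coalg_contr_derel_weak A B)
  simpa using h

theorem diff_contr_fmap {X A B : C.Obj} (f : X ⟶ A) (g : X ⟶ B) :
    diff X ≫ contr X ≫ (fmap f ⊗ₘ fmap g) =
      C.bang X ◁ f ≫ contr X ▷ A ≫ (α_ _ _ _).hom ≫ C.bang X ◁ (β_ _ _).hom ≫ (α_ _ _ _).inv ≫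
          ((fmap f ▷ A ≫ diff A) ⊗ₘ fmap g) +
        C.bang X ◁ g ≫ contr X ▷ B ≫ (α_ _ _ _).hom ≫
          (fmap f ⊗ₘ (fmap g ▷ B ≫ diff B)) := by
  rw [reassoc_of% diff_contr, hom_add_comp]
  simp only [Category.assoc]
  congr 1
  · rw [whiskerRight_comp_tensorHom, ← diff_natural, MonoidalCategory.tensorHom_def' _ f,
      Category.assoc, ← whiskerRight_comp_tensorHom, ← associator_inv_naturality_middle_assoc,
      ← whiskerLeft_comp_assoc, ← braiding_naturality_right, whiskerLeft_comp, Category.assoc,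
      ← associator_naturality_right_assoc, whisker_exchange_assoc]
  · rw [whiskerLeft_comp_tensorHom, ← diff_natural, MonoidalCategory.tensorHom_def' _ g,
      Category.assoc, ← whiskerLeft_comp_tensorHom, ← associator_naturality_right_assoc,
      whisker_exchange_assoc]

theorem coalg_tangent_diff (A B : C.Obj) :
    coalg A B ▷ B ≫ tangent A B ≫ diff _ ≫ contr _ ≫
      (fmap (projL A B) ⊗ₘ fmap (projR A B)) = partialDiff A B := by
  rw [diff_contr_fmap, hom_comp_add, hom_comp_add, reassoc_of% coalg_tangent_projL,
    reassoc_of% coalg_tangent_projR, hom_zero_comp, zero_add]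
  have h := congrArg (· ▷ B ≫ (α_ _ _ _).hom ≫ _ ◁ diff B) (coalg_contr_proj A B)
  rw [partialDiff]
  simp [MonoidalCategory.tensorHom_def] at h ⊢
  exact h

theorem partialDiff_mon (A B : C.Obj) :
    partialDiff A B ≫ mon A B =
      tensorContr A B ▷ B ≫ (α_ _ _ _).hom ≫
        (mon A B ⊗ₘ (partialDiff A B ≫ (derel A ⊗ₘ derel B))) ≫ diff (A ⊗ B) := by
  set g := contr (C.bang A ⊗ C.bang B) ≫ (derel _ ⊗ₘ derel _) ≫ (projL A B ⊗ₘ projR A B) with hg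
  have hg' : dig _ ≫ fmap g = contr _ ≫ (fmap (projL A B) ⊗ₘ fmap (projR A B)) ≫ mon A B := by
    rw [mon_natural, reassoc_of% contr_mon, ← fmap_comp, hg, Category.assoc]
  have hcoalg : coalg A B ≫ dig _ ≫ fmap g = mon A B := by
    rw [hg', reassoc_of% coalg_contr_proj]
  have hderiv : coalg A B ▷ B ≫ tangent A B ≫ diff _ ≫ g =
      partialDiff A B ≫ (derel A ⊗ₘ derel B) := by
    rw [← coalg_tangent_diff, hg, tensorHom_comp_tensorHom, ← fmap_derel, ← fmap_derel]
    simp only [Category.assoc, tensorHom_comp_tensorHom]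
  calc partialDiff A B ≫ mon A B
      = coalg A B ▷ B ≫ tangent A B ≫ diff _ ≫ dig _ ≫ fmap g := by
        rw [← coalg_tangent_diff, hg']
        simp only [Category.assoc]
    _ = coalg A B ▷ B ≫ (tangent A B ≫ contr _ ▷ _ ≫ (α_ _ _ _).hom) ≫
          ((dig _ ≫ fmap g) ⊗ₘ (diff _ ≫ g)) ≫ diff _ := by
        rw [reassoc_of% diff_dig, ← diff_natural, tensorHom_comp_tensorHom_assoc]
        simp only [Category.assoc]
    _ = (coalg A B ≫ contr _) ▷ B ≫ (α_ _ _ _).hom ≫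
          ((dig _ ≫ fmap g) ⊗ₘ (tangent A B ≫ diff _ ≫ g)) ≫ diff _ := by
        rw [tangent_contr, ← id_tensorHom]
        simp only [Category.assoc, tensorHom_comp_tensorHom_assoc, Category.id_comp,
          comp_whiskerRight]
    _ = _ := by
        rw [coalg_contr, comp_whiskerRight, Category.assoc, ← tensorHom_id (_ ⊗ₘ _),
          associator_naturality_assoc, tensorHom_comp_tensorHom_assoc, tensorHom_id, hcoalg, hderiv]

/-- The monoidal rule for the deriving transformation. -/
theorem whiskerLeft_diff_mon (A B : C.Obj) :
    C.bang A ◁ diff B ≫ mon A B =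
      coder A ▷ (C.bang B ⊗ B) ≫ tensorμ _ _ _ _ ≫ mon A B ▷ (A ⊗ B) ≫ diff (A ⊗ B) := by
  have h := partialDiff_mon A B
  have hB : contr B ≫ C.bang B ◁ weak B = (ρ_ _).inv := by
    rw [← cancel_mono (ρ_ _).hom, Category.assoc, contr_weak_right, Iso.inv_hom_id]
  have hs : tensorContr A B ▷ B ≫ (α_ _ _ _).hom ≫ _ ◁ (derel A ⊗ₘ weak B) ▷ B =
      (coder A ⊗ₘ (ρ_ _).inv) ▷ B ≫ tensorμ _ _ _ _ ▷ B ≫ (α_ _ _ _).hom := by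
    rw [← associator_naturality_middle, ← comp_whiskerRight_assoc, tensorContr, Category.assoc,
      ← id_tensorHom, ← id_tensorHom_id, ← tensorμ_natural, tensorHom_comp_tensorHom_assoc,
      id_tensorHom, id_tensorHom, hB, coder, comp_whiskerRight, Category.assoc]
  rw [partialDiff_derel] at h
  have h2 : (α_ (C.bang A) (C.bang B) B).hom ≫ (derel A ⊗ₘ (weak B ▷ B ≫ (λ_ _).hom)) =
    (derel A ⊗ₘ weak B) ▷ B ≫ (α_ _ _ _).hom ≫ A ◁ (λ_ _).hom := by
      simp [MonoidalCategory.tensorHom_def]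
  rw [h2, ← whiskerLeft_comp_tensorHom] at h
  have h3 : ((C.bang A ⊗ A) ◁ (ρ_ (C.bang B)).inv) ▷ B ≫ tensorμ _ _ _ _ ▷ B ≫
      (α_ _ _ _).hom ≫ _ ◁ ((α_ _ _ _).hom ≫ A ◁ (λ_ B).hom) =
        (α_ _ _ _).hom ≫ tensorμ (C.bang A) A (C.bang B) B := by
    simp only [tensorμ]
    monoidal
  simp only [Category.assoc] at h
  rw [reassoc_of% hs, MonoidalCategory.tensorHom_def (coder A),
    MonoidalCategory.tensorHom_def' (mon A B), comp_whiskerRight] at h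
  simp only [Category.assoc] at h
  rw [reassoc_of% h3, ← tensorHom_id (coder A), ← tensorHom_id,
    associator_naturality_assoc, id_tensorHom_id, tensorHom_id, partialDiff, Category.assoc,
    cancel_epi] at h
  exact h

end MonoidalRule

section Antiderivatives

theorem fmap_coder {X Y : C.Obj} (f : X ⟶ Y) :
    fmap f ≫ coder Y = coder X ≫ (fmap f ⊗ₘ f) := by
  simp only [coder, reassoc_of% fmap_contr, ← id_tensorHom, tensorHom_comp_tensorHom,
    Category.assoc, fmap_derel, Category.id_comp, Category.comp_id]

theorem fmap_zero_coder (X Y : C.Obj) : fmap (0 : X ⟶ Y) ≫ coder Y = 0 := by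
  rw [fmap_coder, tensorHom_zero, hom_comp_zero]

theorem diff_fmap_zero (X Y : C.Obj) : diff X ≫ fmap (0 : X ⟶ Y) = 0 := by
  rw [← diff_natural, tensorHom_zero, hom_zero_comp]

theorem fmap_zero_fmap_zero (X : C.Obj) : fmap (0 : X ⟶ X) ≫ fmap (0 : X ⟶ X) = fmap 0 := by
  rw [← fmap_comp, hom_zero_comp]

theorem diff_coder (A : C.Obj) :
    diff A ≫ coder A =
      coder A ▷ A ≫ (α_ _ _ _).hom ≫ C.bang A ◁ (β_ A A).hom ≫ (α_ _ _ _).inv ≫ diff A ▷ A +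
        𝟙 _ := by
  rw [coder, reassoc_of% diff_contr, hom_add_comp]
  congr 1
  · simp only [Category.assoc, comp_whiskerRight]
    rw [← whisker_exchange, ← associator_inv_naturality_right_assoc, ← whiskerLeft_comp_assoc,
      ← braiding_naturality_left, whiskerLeft_comp, Category.assoc,
      ← associator_naturality_middle_assoc]
  · have h := congrArg (· ▷ A) (contr_weak_right A)
    simp only [Category.assoc, ← whiskerLeft_comp, diff_derel]
    simpa using h

theorem coder_coder_braiding (A : C.Obj) :
    coder A ≫ coder A ▷ A ≫ (α_ _ _ _).hom ≫ C.bang A ◁ (β_ A A).hom =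
      coder A ≫ coder A ▷ A ≫ (α_ _ _ _).hom := by
  have h : coder A ≫ coder A ▷ A ≫ (α_ _ _ _).hom =
      contr A ≫ C.bang A ◁ (contr A ≫ (derel A ⊗ₘ derel A)) := by
    rw [whiskerLeft_comp, ← reassoc_of% contr_coassoc]
    simp only [coder, Category.assoc, comp_whiskerRight, whisker_exchange_assoc]
    simp [MonoidalCategory.tensorHom_def]
  rw [reassoc_of% h, h, ← whiskerLeft_comp, Category.assoc, braiding_naturality,
    reassoc_of% contr_braiding]

/-- The number operator `d° d`. -/
def numOp (A : C.Obj) : C.bang A ⟶ C.bang A := coder A ≫ diff A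

theorem fmap_numOp {X Y : C.Obj} (f : X ⟶ Y) : fmap f ≫ numOp Y = numOp X ≫ fmap f := by
  rw [numOp, reassoc_of% fmap_coder, diff_natural, numOp, Category.assoc]

theorem numOp_coder (A : C.Obj) : numOp A ≫ coder A = coder A ≫ (numOp A + 𝟙 _) ▷ A := by
  rw [numOp, Category.assoc, diff_coder, hom_comp_add, reassoc_of% coder_coder_braiding,
    add_whiskerRight, hom_comp_add, Iso.hom_inv_id_assoc, comp_whiskerRight, id_whiskerRight]

theorem diff_numOp (A : C.Obj) :
    diff A ≫ numOp A = (numOp A + 𝟙 _) ▷ A ≫ diff A := by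
  rw [numOp, reassoc_of% diff_coder, hom_add_comp, add_whiskerRight, hom_add_comp,
    comp_whiskerRight, id_whiskerRight]
  simp only [Category.assoc, ← diff_interchange]

theorem whiskerLeft_numOp_mon (A B : C.Obj) :
    C.bang A ◁ numOp B ≫ mon A B = mon A B ≫ numOp (A ⊗ B) := by
  have hA : coder A = contr A ≫ (𝟙 _ ⊗ₘ derel A) := by rw [coder, id_tensorHom]
  have hB : coder B = contr B ≫ (𝟙 _ ⊗ₘ derel B) := by rw [coder, id_tensorHom]
  have hAB : coder (A ⊗ B) = contr _ ≫ (𝟙 _ ⊗ₘ derel _) := by rw [coder, id_tensorHom]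
  rw [numOp, whiskerLeft_comp, Category.assoc, whiskerLeft_diff_mon, numOp, hAB,
    whisker_exchange_assoc, ← MonoidalCategory.tensorHom_def_assoc, hA, hB,
    ← tensorHom_comp_tensorHom_assoc, reassoc_of% tensorμ_natural, Category.assoc,
    reassoc_of% mon_contr, tensorHom_comp_tensorHom_assoc, mon_derel, ← tensorHom_id,
    tensorHom_comp_tensorHom_assoc, id_tensorHom_id]
  simp only [Category.id_comp, Category.comp_id]

theorem numOp_whiskerRight_mon (A B : C.Obj) :
    numOp A ▷ C.bang B ≫ mon A B = mon A B ≫ numOp (A ⊗ B) := by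
  have h : mon A B = (β_ _ _).hom ≫ mon B A ≫ fmap (β_ B A).hom := by
    rw [← braiding_mon, SymmetricCategory.symmetry_assoc]
  rw [h, braiding_naturality_left_assoc, reassoc_of% whiskerLeft_numOp_mon, ← fmap_numOp]
  simp only [Category.assoc]

theorem unit_diff_coder :
    (ρ_ _).inv ≫ diff (𝟙_ C.Obj) ≫ coder _ ≫ (ρ_ _).hom = numOp _ + 𝟙 _ := by
  have hβ : (β_ (𝟙_ C.Obj) (𝟙_ C.Obj)).hom = 𝟙 _ := by
    rw [braiding_tensorUnit_left, unitors_equal, Iso.hom_inv_id]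
  rw [reassoc_of% diff_coder, hβ, hom_add_comp, hom_comp_add, numOp]
  congr 1
  · simp
  · simp

/-- The operation `F(x) ↦ ∫ F(t x)` given by a functional `∫` on `!R`. -/
def scale (u : 𝟙_ C.Obj ⟶ C.bang (𝟙_ C.Obj)) (A : C.Obj) : C.bang A ⟶ C.bang A :=
  (ρ_ _).inv ≫ C.bang A ◁ u ≫ mon A (𝟙_ _) ≫ fmap (ρ_ A).hom

theorem numOp_scale (u : 𝟙_ C.Obj ⟶ C.bang (𝟙_ C.Obj)) (A : C.Obj) :
    numOp A ≫ scale u A = scale u A ≫ numOp A := by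
  simp only [scale, Category.assoc, fmap_numOp]
  rw [← reassoc_of% numOp_whiskerRight_mon, whisker_exchange_assoc,
    rightUnitor_inv_naturality_assoc]

theorem scale_numOp_add_id {u : 𝟙_ C.Obj ⟶ C.bang (𝟙_ C.Obj)}
    (hu : u ≫ (numOp _ + 𝟙 _) = C.monUnit) (A : C.Obj) : scale u A ≫ (numOp A + 𝟙 _) = 𝟙 _ := by
  have h := mon_unit_right A
  rw [← hu, hom_comp_add, whiskerLeft_add, hom_add_comp, hom_comp_add] at h
  rw [hom_comp_add, Category.comp_id]
  refine Eq.trans ?_ h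
  simp only [scale, Category.assoc, fmap_numOp, ← reassoc_of% whiskerLeft_numOp_mon,
    Category.comp_id, whiskerLeft_comp]

theorem scale_diff (u : 𝟙_ C.Obj ⟶ C.bang (𝟙_ C.Obj)) (A : C.Obj) :
    (ρ_ _).inv ≫ C.bang A ◁ (u ≫ (ρ_ _).inv ≫ diff _) ≫ mon A (𝟙_ _) ≫ fmap (ρ_ A).hom =
      coder A ≫ scale u A ▷ A ≫ diff A := by
  have h : (ρ_ (C.bang A ⊗ A)).inv ≫ (C.bang A ⊗ A) ◁ (λ_ (𝟙_ _)).inv ≫ tensorμ _ _ _ _ =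
      ((ρ_ _).inv ⊗ₘ (ρ_ _).inv) := by
    rw [← cancel_mono ((ρ_ (C.bang A)).hom ⊗ₘ (ρ_ A).hom), tensorHom_comp_tensorHom,
      Iso.inv_hom_id, Iso.inv_hom_id, id_tensorHom_id, Category.assoc, Category.assoc,
      ← tensor_right_unitality, Iso.inv_hom_id]
  rw [rightUnitor_inv_naturality_assoc, ← unitors_inv_equal, whiskerLeft_comp, whiskerLeft_comp,
    Category.assoc, Category.assoc, reassoc_of% whiskerLeft_diff_mon, ← diff_natural,
    whisker_exchange_assoc, whisker_exchange_assoc, ← rightUnitor_inv_naturality_assoc,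
    ← tensorHom_id u, reassoc_of% tensorμ_natural_right, reassoc_of% h]
  congr 1
  simp only [← tensorHom_id, ← id_tensorHom, tensorHom_comp_tensorHom_assoc, scale,
    Category.id_comp, id_tensorHom_id, Iso.inv_hom_id]

theorem coder_scale_diff {s : C.bang (𝟙_ C.Obj) ⟶ C.bang (𝟙_ C.Obj)}
    (hs : s ≫ (ρ_ _).inv ≫ diff _ + fmap 0 = 𝟙 _) (A : C.Obj) :
    coder A ≫ scale (C.monUnit ≫ s) A ▷ A ≫ diff A + fmap 0 = 𝟙 _ := by
  have h := mon_unit_right A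
  rw [← Category.comp_id C.monUnit, ← hs, hom_comp_add, whiskerLeft_add,
    hom_add_comp, hom_comp_add] at h
  rw [← h]
  congr 1
  · simpa only [Category.assoc] using (scale_diff (C.monUnit ≫ s) A).symm
  · rw [whiskerLeft_comp, Category.assoc, ← id_tensorHom _ (fmap 0), ← fmap_id,
      reassoc_of% mon_natural, tensorHom_zero, ← fmap_comp, hom_zero_comp,
      ← hom_comp_zero (ρ_ A).hom, fmap_comp, reassoc_of% mon_unit_right]

theorem exists_inverse_numOp_add_fmap_zero {s : C.bang (𝟙_ C.Obj) ⟶ C.bang (𝟙_ C.Obj)}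
    (hs : s ≫ (ρ_ _).inv ≫ diff _ + fmap 0 = 𝟙 _) (A : C.Obj) :
    ∃ g : C.bang A ⟶ C.bang A,
      (numOp A + fmap 0) ≫ g = 𝟙 _ ∧ g ≫ (numOp A + fmap 0) = 𝟙 _ := by
  have hu : (C.monUnit ≫ s) ≫ (numOp _ + 𝟙 _) = C.monUnit := by
    have h := congrArg (C.monUnit ≫ · ≫ coder _ ≫ (ρ_ _).hom) hs
    simp only [hom_add_comp, Category.assoc, unit_diff_coder, reassoc_of% fmap_zero_coder,
      hom_zero_comp, Category.id_comp] at h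
    rw [_root_.add_zero] at h
    rw [Category.assoc, h, coder, Category.assoc, reassoc_of% monUnit_contr, ← id_tensorHom,
      tensorHom_comp_tensorHom_assoc, monUnit_derel, Category.comp_id, tensorHom_id,
      rightUnitor_naturality, ← unitors_equal, Iso.inv_hom_id_assoc]
  set I := scale (C.monUnit ≫ s) A
  have hIJ : I ≫ (numOp A + 𝟙 _) = 𝟙 _ := scale_numOp_add_id hu A
  have hJI : (numOp A + 𝟙 _) ≫ I = 𝟙 _ := by
    rw [hom_comp_add, Category.comp_id] at hIJ
    rw [hom_add_comp, numOp_scale, Category.id_comp]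
    exact hIJ
  have hI := coder_scale_diff hs A
  refine ⟨coder A ≫ (I ≫ I) ▷ A ≫ diff A + fmap 0, ?_, ?_⟩
  · rw [hom_add_comp, hom_comp_add, hom_comp_add, reassoc_of% numOp_coder,
      reassoc_of% fmap_zero_coder, ← comp_whiskerRight_assoc, reassoc_of% hJI, numOp,
      Category.assoc, diff_fmap_zero, hom_comp_zero, hom_zero_comp, _root_.zero_add,
      _root_.add_zero, fmap_zero_fmap_zero, hI]
  · rw [hom_add_comp, hom_comp_add, hom_comp_add, Category.assoc, Category.assoc, diff_numOp,
      ← comp_whiskerRight_assoc, Category.assoc, hIJ, Category.comp_id, Category.assoc,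
      Category.assoc, diff_fmap_zero, numOp, reassoc_of% fmap_zero_coder,
      hom_comp_zero, hom_comp_zero, hom_zero_comp, _root_.zero_add, _root_.add_zero,
      fmap_zero_fmap_zero, hI]

theorem exists_integral_unit {g : C.bang (𝟙_ C.Obj) ⟶ C.bang (𝟙_ C.Obj)}
    (hg : g ≫ (numOp _ + fmap 0) = 𝟙 _) :
    ∃ s : C.bang (𝟙_ C.Obj) ⟶ C.bang (𝟙_ C.Obj), s ≫ (ρ_ _).inv ≫ diff _ + fmap 0 = 𝟙 _ := by
  have h0 : (numOp _ + fmap 0) ≫ fmap (0 : 𝟙_ C.Obj ⟶ 𝟙_ C.Obj) = fmap 0 := by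
    rw [hom_add_comp, numOp, Category.assoc, diff_fmap_zero, hom_comp_zero, _root_.zero_add,
      fmap_zero_fmap_zero]
  have h : g ≫ fmap (0 : 𝟙_ C.Obj ⟶ 𝟙_ C.Obj) = fmap 0 := by
    conv_lhs => rw [← h0, reassoc_of% hg]
  refine ⟨g ≫ coder _ ≫ (ρ_ _).hom, ?_⟩
  rw [hom_comp_add, h, numOp] at hg
  simpa using hg

end Antiderivatives

end DiffLinCat

/-- Theorem (main technical result): a differential linear category has
antiderivatives (K is a natural isomorphism) iff there is a map
s_R : !R → !R with s_R d_R + !(0) = 1_{!R}. -/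
theorem statement14 (C : DiffLinCat) :
    (∀ A : C.Obj, ∃ g : C.Hom (C.bang A) (C.bang A),
        C.comp (C.K A) g = C.id (C.bang A) ∧ C.comp g (C.K A) = C.id (C.bang A)) ↔
    (∃ sR : C.Hom (C.bang C.unit) (C.bang C.unit),
      C.add (C.comp sR C.dR) (C.bangMap (C.zero : C.Hom C.unit C.unit)) =
        C.id (C.bang C.unit)) := by
  constructor
  · intro h
    obtain ⟨g, -, hg⟩ := h C.unit
    exact DiffLinCat.exists_integral_unit hg
  · rintro ⟨s, hs⟩ A
    exact DiffLinCat.exists_inverse_numOp_add_fmap_zero hs A
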